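/- Let G be a Berge graph that is not perfect and such that every Berge graph with fewer vertices than G is perfect (a minimum imperfect Berge graph). Then G admits no balanced skew partition. -/

import Mathlib

open SimpleGraph

/-- `G` contains a hole (induced cycle) on `n` vertices. -/
def HasHoleOfLength {V : Type} (G : SimpleGraph V) (n : ℕ) : Prop :=
  Nonempty (cycleGraph n ↪g G)

/-- A graph is Berge if neither it nor its complement contains an induced odd cycle
on at least 5 vertices (no odd hole, no odd antihole). -/
def IsBerge {V : Type} (G : SimpleGraph V) : Prop :=
  ∀ n : ℕ, 5 ≤ n → Odd n → ¬ HasHoleOfLength G n ∧ ¬ HasHoleOfLength Gᶜ n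

/-- A graph is perfect if every induced subgraph has chromatic number equal to
its clique number. -/
def IsPerfect {V : Type} (G : SimpleGraph V) : Prop :=
  ∀ s : Set V, (G.induce s).chromaticNumber = ((G.induce s).cliqueNum : ℕ∞)

/-- The vertices of `s` split into two nonempty parts with no edges of `G`
between them (so `G[s]` is disconnected). -/
def IsDisconnectedOn {V : Type} (G : SimpleGraph V) (s : Set V) : Prop :=
  ∃ X Y : Set V, X.Nonempty ∧ Y.Nonempty ∧ Disjoint X Y ∧ X ∪ Y = s ∧
    ∀ x ∈ X, ∀ y ∈ Y, ¬ G.Adj x y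

/-- A skew partition of `G`: a partition `(A, B)` of the vertices with `G[A]`
disconnected and the complement of `G[B]` disconnected. -/
def IsSkewPartition {V : Type} (G : SimpleGraph V) (A B : Set V) : Prop :=
  Disjoint A B ∧ A ∪ B = Set.univ ∧ IsDisconnectedOn G A ∧ IsDisconnectedOn Gᶜ B

/-- The pair of sets `(A, B)` is balanced in `G`. -/
def IsBalancedPair {V : Type} (G : SimpleGraph V) (A B : Set V) : Prop :=
  (∀ (n : ℕ) (hn : 4 ≤ n) (f : pathGraph n ↪g G),
      (f ⟨0, by omega⟩ : V) ∈ B → (f ⟨n - 1, by omega⟩ : V) ∈ B →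
      (∀ i : Fin n, i.val ≠ 0 → i.val ≠ n - 1 → (f i : V) ∈ A) → Even (n - 1)) ∧
  (∀ (n : ℕ) (hn : 4 ≤ n) (f : pathGraph n ↪g Gᶜ),
      (f ⟨0, by omega⟩ : V) ∈ A → (f ⟨n - 1, by omega⟩ : V) ∈ A →
      (∀ i : Fin n, i.val ≠ 0 → i.val ≠ n - 1 → (f i : V) ∈ B) → Even (n - 1))

namespace BergeSkew

section

open Classical Finset

variable {V : Type}

/-- `s` admits a proper colouring of the subgraph it induces with colours `0, …, m - 1`. -/
def ColorableOn (G : SimpleGraph V) (s : Finset V) (m : ℕ) : Prop :=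
  ∃ c : V → ℕ, (∀ v ∈ s, c v < m) ∧ ∀ u ∈ s, ∀ v ∈ s, G.Adj u v → c u ≠ c v

/-- All cliques of `G` inside `s` have at most `m` vertices. -/
def CliqueBound (G : SimpleGraph V) (s : Finset V) (m : ℕ) : Prop :=
  ∀ Q ⊆ s, G.IsClique (Q : Set V) → #Q ≤ m

/-- The subgraph induced by `s` has chromatic number at most its clique number. -/
def OptimallyColorableOn (G : SimpleGraph V) (s : Finset V) : Prop :=
  ∀ m, CliqueBound G s m → ColorableOn G s m

lemma ColorableOn.union {G : SimpleGraph V} {s t : Finset V} {m n : ℕ}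
    (hs : ColorableOn G s m) (ht : ColorableOn G t n) : ColorableOn G (s ∪ t) (m + n) := by
  obtain ⟨c, hc, hc'⟩ := hs
  obtain ⟨d, hd, hd'⟩ := ht
  refine ⟨fun v => if v ∈ s then c v else m + d v, ?_, ?_⟩
  · intro v hv
    grind
  · intro u hu v hv huv
    have := hc' u
    have := hd' u
    grind

lemma ColorableOn.mono {G : SimpleGraph V} {s t : Finset V} {m n : ℕ}
    (hs : ColorableOn G s m) (hts : t ⊆ s) (hmn : m ≤ n) : ColorableOn G t n := by
  obtain ⟨c, hc, hc'⟩ := hs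
  exact ⟨c, fun v hv => (hc v (hts hv)).trans_le hmn,
    fun u hu v hv => hc' u (hts hu) v (hts hv)⟩

lemma colorableOn_one {G : SimpleGraph V} {s : Finset V} (hs : G.IsIndepSet (s : Set V)) :
    ColorableOn G s 1 :=
  ⟨fun _ => 0, by simp, fun u hu v hv huv => (hs hu hv huv.ne huv).elim⟩

lemma isIndepSet_subset {G : SimpleGraph V} {s t : Set V} (h : G.IsIndepSet s) (hts : t ⊆ s) :
    G.IsIndepSet t :=
  Set.Pairwise.mono hts h

lemma card_inter_le_one {G : SimpleGraph V} {Q S : Finset V} (hQ : G.IsClique (Q : Set V))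
    (hS : G.IsIndepSet (S : Set V)) : #(Q ∩ S) ≤ 1 := by
  rw [card_le_one]
  intro a ha b hb
  by_contra hab
  rw [mem_inter] at ha hb
  exact hS ha.2 hb.2 hab (hQ ha.1 hb.1 hab)

/-- Each stable set of a family contributes at most one to the total cover of a clique. -/
lemma sum_card_cover_le {G : SimpleGraph V} {Q : Finset V} (hQ : G.IsClique (Q : Set V))
    {f : ℕ → Finset V} (hf : ∀ i, G.IsIndepSet (f i : Set V)) (J : Finset ℕ) :
    ∑ v ∈ Q, #{i ∈ J | v ∈ f i} ≤ #{i ∈ J | (Q ∩ f i).Nonempty} := by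
  have h : ∑ v ∈ Q, #{i ∈ J | v ∈ f i} = ∑ i ∈ J, #(Q ∩ f i) := by
    simp_rw [card_filter, ← filter_mem_eq_inter, card_filter]
    exact sum_comm
  rw [h, card_filter]
  refine sum_le_sum fun i _ => ?_
  split_ifs with hi
  · exact card_inter_le_one hQ (hf i)
  · rw [not_nonempty_iff_eq_empty] at hi
    simp [hi]

section Weighted

variable [Fintype V] {G : SimpleGraph V} {s : Finset V}

/-- Lovász's replication lemma in weighted form. -/
theorem exists_weighted_cover (hG : ∀ t ⊆ s, OptimallyColorableOn G t) :
    ∀ (N : ℕ) (w : V → ℕ) (m : ℕ), ∑ v, w v ≤ N → (∀ v, 0 < w v → v ∈ s) →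
      (∀ Q : Finset V, G.IsClique (Q : Set V) → ∑ v ∈ Q, w v ≤ m) →
      ∃ f : ℕ → Finset V, (∀ i, G.IsIndepSet (f i : Set V)) ∧
        ∀ v, w v ≤ #{i ∈ range m | v ∈ f i} := by
  intro N
  induction N with
  | zero =>
    intro w m hN _ _
    refine ⟨fun _ => ∅, by simp [SimpleGraph.IsIndepSet], fun v => ?_⟩
    have := single_le_sum (fun v _ => Nat.zero_le (w v)) (mem_univ v)
    omega
  | succ N ih =>
    intro w m hN hws hm
    by_cases hx : ∃ x, 2 ≤ w x
    · obtain ⟨x, hx⟩ := hx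
      set w' : V → ℕ := fun v => if v = x then w v - 1 else w v with hw'
      have hle : ∀ v, w' v ≤ w v := fun v => by simp only [hw']; split_ifs <;> omega
      have hsum' : ∑ v, w' v < ∑ v, w v :=
        sum_lt_sum (fun v _ => hle v) ⟨x, mem_univ x, by simp [hw']; omega⟩
      obtain ⟨f, hf, hfw⟩ := ih w' m (by omega) (fun v hv => hws v (hv.trans_le (hle v)))
        (fun Q hQ => (sum_le_sum fun v _ => hle v).trans (hm Q hQ))
      have hx0 : 0 < #{i ∈ range m | x ∈ f i} :=
        lt_of_lt_of_le (by simp [hw']; omega) (hfw x)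
      obtain ⟨i₀, hi₀⟩ := card_pos.1 hx0
      rw [mem_filter, mem_range] at hi₀
      set S := f i₀
      set h : V → ℕ := fun v => if v ∈ S ∧ v ≠ x then w' v - 1 else w' v with hh
      have hhle : ∀ v, h v ≤ w' v := fun v => by simp only [hh]; split_ifs <;> omega
      have hclq : ∀ Q : Finset V, G.IsClique (Q : Set V) → ∑ v ∈ Q, h v ≤ m - 1 := by
        intro Q hQ
        by_contra! hlt
        have h1 := sum_le_sum fun v (_ : v ∈ Q) => hhle v
        have h2 := sum_le_sum fun v (_ : v ∈ Q) => hle v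
        have h3 := hm Q hQ
        have e1 := (sum_eq_sum_iff_of_le fun v (_ : v ∈ Q) => hhle v).1 (by omega)
        have e2 := (sum_eq_sum_iff_of_le fun v (_ : v ∈ Q) => hle v).1 (by omega)
        have hxQ : x ∉ Q := fun hxQ => by
          have := e2 x hxQ
          simp [hw'] at this
          omega
        set P := Q.filter (fun v => 0 < w' v) with hP
        have hPsum : ∑ v ∈ P, w' v = ∑ v ∈ Q, w' v :=
          sum_subset (filter_subset _ _) (fun v hv hv' => by simp [hP, hv] at hv'; exact hv')
        have hPcl : G.IsClique (P : Set V) :=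
          hQ.subset (by exact_mod_cast filter_subset _ _)
        have hPS : ¬ (P ∩ S).Nonempty := by
          rintro ⟨v, hv⟩
          rw [mem_inter, hP, mem_filter] at hv
          have hvx : v ≠ x := fun e => hxQ (e ▸ hv.1.1)
          have := e1 v hv.1.1
          simp only [hh, hv.2, hvx, ne_eq, not_false_eq_true, and_self, if_true] at this
          omega
        have h4 := sum_le_sum fun v (_ : v ∈ P) => hfw v
        have h5 := sum_card_cover_le hPcl hf (range m)
        have h6 : #{i ∈ range m | (P ∩ f i).Nonempty} < #(range m) := by
          refine card_lt_card (filter_ssubset.2 ⟨i₀, mem_range.2 hi₀.1, hPS⟩)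
        rw [card_range] at h6
        omega
      have hhsum : ∑ v, h v ≤ ∑ v, w' v := sum_le_sum fun v _ => hhle v
      obtain ⟨g, hg, hgw⟩ := ih h (m - 1) (by omega)
        (fun v hv => hws v (hv.trans_le ((hhle v).trans (hle v)))) hclq
      refine ⟨fun i => if i = m - 1 then S else g i, fun i => ?_, fun v => ?_⟩
      · dsimp only
        split_ifs
        · exact hf i₀
        · exact hg i
      · obtain ⟨k, rfl⟩ : ∃ k, m = k + 1 := ⟨m - 1, by omega⟩
        have hcount : #{i ∈ range (k + 1) | v ∈ if i = k + 1 - 1 then S else g i} =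
            #{i ∈ range k | v ∈ g i} + if v ∈ S then 1 else 0 := by
          simp only [card_filter, sum_range_succ, Nat.add_sub_cancel, if_true]
          congr 1
          refine sum_congr rfl fun i hi => ?_
          rw [if_neg (mem_range.1 hi).ne]
        rw [hcount]
        have h1 := hgw v
        simp only [Nat.add_sub_cancel, hh, hw'] at h1
        have hxS : x ∈ S := hi₀.2
        by_cases hv : v = x
        · subst hv
          simp only [hxS, ne_eq, not_true_eq_false, and_false, if_false, if_true] at h1 ⊢
          omega
        · by_cases hvS : v ∈ S <;> simp [hv, hvS] at h1 ⊢ <;> omega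
    · push Not at hx
      set t : Finset V := univ.filter (fun v => 0 < w v) with ht
      obtain ⟨c, hc, hc'⟩ := hG t (fun v hv => hws v (by simpa [ht] using hv)) m (by
        intro Q hQ hQc
        refine le_trans ?_ (hm Q hQc)
        rw [card_eq_sum_ones]
        refine sum_le_sum fun v hv => ?_
        have := hQ hv
        simp [ht] at this
        omega)
      refine ⟨fun i => t.filter (fun v => c v = i), fun i u hu v hv _ huv => ?_, fun v => ?_⟩
      · simp only [coe_filter, Set.mem_ofPred_eq] at hu hv
        exact hc' u hu.1 v hv.1 huv (hu.2.trans hv.2.symm)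
      · by_cases hv : v ∈ t
        · have h1 := hx v
          change w v ≤ #{i ∈ range m | v ∈ t.filter (fun v => c v = i)}
          have : 0 < #{i ∈ range m | v ∈ t.filter (fun v => c v = i)} :=
            card_pos.2 ⟨c v, by simp [hv, hc v hv]⟩
          omega
        · simp [ht] at hv
          omega

/-- Lovász's weak perfect graph theorem. -/
theorem optimallyColorableOn_compl (hG : ∀ t : Finset V, OptimallyColorableOn G t) :
    ∀ (n : ℕ) (s : Finset V), #s ≤ n → OptimallyColorableOn Gᶜ s := by
  intro n
  induction n with
  | zero =>
    intro s hs m _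
    have : s = ∅ := card_eq_zero.1 (by omega)
    subst this
    exact ⟨fun _ => 0, by simp, by simp⟩
  | succ n ih =>
    intro s hs m hm
    rcases s.eq_empty_or_nonempty with rfl | ⟨v₀, hv₀⟩
    · exact ⟨fun _ => 0, by simp, by simp⟩
    have hm1 : 1 ≤ m := by simpa using hm {v₀} (by simpa using hv₀) (by simp)
    by_cases hK : ∃ K ⊆ s, G.IsClique (K : Set V) ∧
        ∀ S ⊆ s, G.IsIndepSet (S : Set V) → #S = m → (K ∩ S).Nonempty
    · obtain ⟨K, hKs, hKc, hK⟩ := hK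
      by_cases hKe : K.Nonempty
      · obtain ⟨k, rfl⟩ : ∃ k, m = k + 1 := ⟨m - 1, by omega⟩
        have hcard : #(s \ K) ≤ n := by
          rw [card_sdiff_of_subset hKs]
          have := card_pos.2 hKe
          omega
        have h1 : ColorableOn Gᶜ (s \ K) k := by
          refine ih _ hcard k fun S hS hSc => ?_
          have hSs := hS.trans sdiff_subset
          have h2 := hm S hSs hSc
          by_contra! hlt
          obtain ⟨v, hv⟩ := hK S hSs (by simpa using hSc) (by omega)
          rw [mem_inter] at hv
          exact (mem_sdiff.1 (hS hv.2)).2 hv.1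
        have h2 : ColorableOn Gᶜ K 1 := colorableOn_one (by simpa using hKc)
        exact (h1.union h2).mono (by simp) le_rfl
      · rw [not_nonempty_iff_eq_empty] at hKe
        subst hKe
        obtain ⟨k, rfl⟩ : ∃ k, m = k + 1 := ⟨m - 1, by omega⟩
        have hnone : CliqueBound Gᶜ s k := by
          intro S hS hSc
          have h2 := hm S hS hSc
          by_contra! hlt
          simpa using hK S hS (by simpa using hSc) (by omega)
        have h1 : ColorableOn Gᶜ (s.erase v₀) k := by
          refine ih _ (by rw [card_erase_of_mem hv₀]; omega) k fun S hS hSc => ?_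
          exact hnone S (hS.trans (erase_subset _ _)) hSc
        have h2 : ColorableOn Gᶜ {v₀} 1 := colorableOn_one (by simp [SimpleGraph.IsIndepSet])
        refine (h1.union h2).mono (fun v hv => ?_) le_rfl
        by_cases h : v = v₀ <;> simp [h, hv]
    · push Not at hK
      exfalso
      choose! A hAs hAi hAm hAK using hK
      set 𝒦 : Finset (Finset V) := s.powerset.filter (fun K => G.IsClique (K : Set V)) with h𝒦
      have mem𝒦 : ∀ K, K ∈ 𝒦 ↔ K ⊆ s ∧ G.IsClique (K : Set V) := by simp [h𝒦]
      have h𝒦0 : 0 < #𝒦 := card_pos.2 ⟨∅, by simp [mem𝒦]⟩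
      set w : V → ℕ := fun v => #{K ∈ 𝒦 | v ∈ A K} with hw
      have hws : ∀ v, 0 < w v → v ∈ s := by
        intro v hv
        obtain ⟨K, hK⟩ := card_pos.1 hv
        rw [mem_filter, mem𝒦] at hK
        exact hAs K hK.1.1 hK.1.2 hK.2
      have hswap : ∀ Q : Finset V, ∑ v ∈ Q, w v = ∑ K ∈ 𝒦, #(Q ∩ A K) := by
        intro Q
        simp_rw [hw, card_filter, ← filter_mem_eq_inter, card_filter]
        exact sum_comm
      obtain ⟨f, hf, hfw⟩ := exists_weighted_cover (s := s) (fun t _ => hG t) _ w (#𝒦 - 1) le_rfl hws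
        (by
          intro Q hQ
          rw [hswap]
          have hQ𝒦 : Q ∩ s ∈ 𝒦 := by
            rw [mem𝒦]
            exact ⟨inter_subset_right, hQ.subset (by simp)⟩
          rw [← sum_erase_add _ _ hQ𝒦]
          have h0 : #(Q ∩ A (Q ∩ s)) = 0 := by
            rw [mem𝒦] at hQ𝒦
            rw [card_eq_zero, ← hAK _ hQ𝒦.1 hQ𝒦.2]
            ext v
            have : v ∈ A (Q ∩ s) → v ∈ s := fun h => hAs _ hQ𝒦.1 hQ𝒦.2 h
            simp only [mem_inter]
            tauto
          rw [h0, add_zero, ← card_erase_of_mem hQ𝒦, card_eq_sum_ones]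
          refine sum_le_sum fun K hK => ?_
          have hK := (mem𝒦 K).1 (mem_of_mem_erase hK)
          exact card_inter_le_one hQ (hAi K hK.1 hK.2))
      have e1 : ∑ v ∈ s, w v = #𝒦 * m := by
        rw [hswap, ← smul_eq_mul, ← sum_const]
        refine sum_congr rfl fun K hK => ?_
        rw [mem𝒦] at hK
        rw [inter_eq_right.2 (hAs K hK.1 hK.2), hAm K hK.1 hK.2]
      have e2 : ∑ v ∈ s, w v ≤ (#𝒦 - 1) * m := by
        refine (sum_le_sum fun v _ => hfw v).trans ?_
        have : ∑ v ∈ s, #{i ∈ range (#𝒦 - 1) | v ∈ f i} =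
            ∑ i ∈ range (#𝒦 - 1), #(s ∩ f i) := by
          simp_rw [card_filter, ← filter_mem_eq_inter, card_filter]
          exact sum_comm
        rw [this]
        refine (sum_le_card_nsmul _ _ m fun i _ => ?_).trans (by simp)
        refine hm _ inter_subset_left ?_
        simpa using isIndepSet_subset (hf i) (by simp)
      have : (#𝒦 - 1) * m < #𝒦 * m := Nat.mul_lt_mul_of_pos_right (by omega) hm1
      omega

end Weighted

/-- Chvátal's star cutset lemma: a graph whose proper induced subgraphs are optimally colourable
and which has a star cutset `A` is optimally colourable. -/
theorem optimallyColorableOn_univ_of_starCutset [Fintype V] {H : SimpleGraph V}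
    (hH : ∀ t : Finset V, t ≠ univ → OptimallyColorableOn H t) {A X Y : Finset V} {a : V}
    (hcov : ∀ v, v ∈ A ∨ v ∈ X ∨ v ∈ Y) (hX : X.Nonempty) (hY : Y.Nonempty)
    (hAX : Disjoint A X) (hAY : Disjoint A Y) (hdXY : Disjoint X Y)
    (hXY : ∀ x ∈ X, ∀ y ∈ Y, ¬ H.Adj x y) (ha : a ∈ A)
    (hstar : ∀ v ∈ A, v ≠ a → H.Adj a v) : OptimallyColorableOn H univ := by
  intro m hm
  have hm1 : 1 ≤ m := by simpa using hm {a} (subset_univ _) (by simp)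
  rw [Finset.disjoint_left] at hAX hAY hdXY
  have haX := hAX ha
  have haY := hAY ha
  obtain ⟨x₀, hx₀⟩ := hX
  obtain ⟨y₀, hy₀⟩ := hY
  have sub : ∀ t : Finset V, CliqueBound H t m := fun t Q _ hQc => hm Q (subset_univ _) hQc
  obtain ⟨c, hc, hc'⟩ := hH (univ \ Y)
    (fun h => by have := mem_univ y₀; rw [← h] at this; simp [hy₀] at this) m (sub _)
  obtain ⟨d, hd, hd'⟩ := hH (univ \ X)
    (fun h => by have := mem_univ x₀; rw [← h] at this; simp [hx₀] at this) m (sub _)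
  simp only [mem_sdiff, mem_univ, true_and] at hc hc' hd hd'
  set T : Finset V := univ.filter (fun v => (v ∉ Y ∧ c v = c a) ∨ (v ∉ X ∧ d v = d a)) with hT
  have memT : ∀ v, v ∈ T ↔ (v ∉ Y ∧ c v = c a) ∨ (v ∉ X ∧ d v = d a) := by simp [hT]
  have hTA : ∀ v ∈ T, v ∈ A → v = a := by
    intro v hv hvA
    by_contra hva
    have hadj := hstar v hvA hva
    rcases (memT v).1 hv with h | h
    · exact hc' a haY v h.1 hadj h.2.symm
    · exact hd' a haX v h.1 hadj h.2.symm
  have hTi : H.IsIndepSet (T : Set V) := by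
    have key : ∀ u v, (u ∉ Y ∧ c u = c a) → (v ∉ X ∧ d v = d a) → u ∈ T → v ∈ T →
        ¬ H.Adj u v := by
      intro u v hu hv huT hvT huv
      by_cases huA : u ∈ A
      · obtain rfl := hTA u huT huA
        exact hd' u haX v hv.1 huv hv.2.symm
      by_cases hvA : v ∈ A
      · obtain rfl := hTA v hvT hvA
        exact hc' u hu.1 v haY huv hu.2
      have h1 := hcov u
      have h2 := hcov v
      exact hXY u (by tauto) v (by tauto) huv
    intro u hu v hv _ huv
    have hu' := hu
    have hv' := hv
    rw [mem_coe, memT] at hu' hv'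
    rcases hu' with hu' | hu' <;> rcases hv' with hv' | hv'
    · exact hc' u hu'.1 v hv'.1 huv (hu'.2.trans hv'.2.symm)
    · exact key u v hu' hv' hu hv huv
    · exact key v u hv' hu' hv hu huv.symm
    · exact hd' u hu'.1 v hv'.1 huv (hu'.2.trans hv'.2.symm)
  have count : ∀ (e : V → ℕ) (Q : Finset V), (∀ v ∈ Q, e v < m ∧ e v ≠ e a) → e a < m →
      (∀ u ∈ Q, ∀ v ∈ Q, H.Adj u v → e u ≠ e v) → H.IsClique (Q : Set V) → #Q ≤ m - 1 := by
    intro e Q h1 h2 h3 h4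
    have : #Q ≤ #((range m).erase (e a)) := by
      refine card_le_card_of_injOn e (fun v hv => ?_) (fun u hu v hv huv => ?_)
      · have := h1 v hv
        simp [this]
      · by_contra hne
        exact h3 u hu v hv (h4 hu hv hne) huv
    rwa [card_erase_of_mem (mem_range.2 h2), card_range] at this
  have haT : a ∈ T := (memT a).2 (Or.inl ⟨haY, rfl⟩)
  have hrest : ColorableOn H (univ \ T) (m - 1) := by
    refine hH _ (fun h => ?_) _ fun Q hQ hQc => ?_
    · have := mem_univ a
      rw [← h] at this
      simp [haT] at this
    · have hQT : ∀ v ∈ Q, v ∉ T := fun v hv => (mem_sdiff.1 (hQ hv)).2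
      by_cases hQY : ∀ v ∈ Q, v ∉ Y
      · refine count c Q (fun v hv => ⟨hc v (hQY v hv), fun h => ?_⟩) (hc a haY)
          (fun u hu v hv => hc' u (hQY u hu) v (hQY v hv)) hQc
        exact hQT v hv ((memT v).2 (Or.inl ⟨hQY v hv, h⟩))
      · push Not at hQY
        obtain ⟨y, hyQ, hyY⟩ := hQY
        have hQX : ∀ v ∈ Q, v ∉ X := by
          intro v hv hvX
          by_cases hvy : v = y
          · subst hvy
            exact hdXY hvX hyY
          · exact hXY v hvX y hyY (hQc hv hyQ hvy)
        refine count d Q (fun v hv => ⟨hd v (hQX v hv), fun h => ?_⟩) (hd a haX)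
          (fun u hu v hv => hd' u (hQX u hu) v (hQX v hv)) hQc
        exact hQT v hv ((memT v).2 (Or.inr ⟨hQX v hv, h⟩))
  refine (hrest.union (colorableOn_one hTi)).mono (by simp) (by omega)

/-- The subgraph of `G` induced by a perfect vertex set is optimally colourable on subsets. -/
lemma optimallyColorableOn_of_isPerfect_induce [Fintype V] {G : SimpleGraph V} {s : Set V}
    (h : IsPerfect (G.induce s)) {t : Finset V} (hts : (t : Set V) ⊆ s) :
    OptimallyColorableOn G t := by
  intro m hm
  set r : Set s := {x | (x : V) ∈ t} with hr
  have h1 := h r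
  have h2 : (((G.induce s).induce r).cliqueNum) ≤ m := by
    obtain ⟨Q, hQ⟩ := ((G.induce s).induce r).exists_isNClique_cliqueNum
    rw [← hQ.card_eq, ← card_map ((Function.Embedding.subtype (· ∈ r)).trans
      (Function.Embedding.subtype (· ∈ s)))]
    refine hm _ (fun v hv => ?_) ?_
    · obtain ⟨x, _, rfl⟩ := mem_map.1 hv
      exact x.2
    · intro u hu v hv huv
      obtain ⟨x, hx, rfl⟩ := mem_map.1 (mem_coe.1 hu)
      obtain ⟨y, hy, rfl⟩ := mem_map.1 (mem_coe.1 hv)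
      exact hQ.isClique hx hy (fun e => huv (by rw [e]))
  have h3 : ((G.induce s).induce r).Colorable m := by
    rw [← SimpleGraph.chromaticNumber_le_iff_colorable, h1]
    exact_mod_cast h2
  obtain ⟨c⟩ := h3
  refine ⟨fun v => if hv : v ∈ t then c ⟨⟨v, hts hv⟩, hv⟩ else 0, fun v hv => by simp [hv],
    fun u hu v hv huv => ?_⟩
  simp only [hu, hv, dif_pos]
  intro e
  refine c.valid (v := ⟨⟨u, hts hu⟩, hu⟩) (w := ⟨⟨v, hts hv⟩, hv⟩) huv (Fin.ext e)

lemma isPerfect_of_optimallyColorableOn [Fintype V] {G : SimpleGraph V}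
    (h : ∀ t : Finset V, OptimallyColorableOn G t) : IsPerfect G := by
  intro s
  refine le_antisymm ?_ SimpleGraph.cliqueNum_le_chromaticNumber
  rw [SimpleGraph.chromaticNumber_le_iff_colorable]
  obtain ⟨c, hc, hc'⟩ := h s.toFinset (G.induce s).cliqueNum (by
    intro Q hQ hQc
    have hQs : ∀ v ∈ Q, v ∈ s := fun v hv => by simpa using hQ hv
    have hinj : Function.Injective fun v : Q => (⟨v.1, hQs _ v.2⟩ : s) := fun x y e =>
      Subtype.ext (congrArg Subtype.val e :)
    have hcard : #(Q.attach.map ⟨_, hinj⟩) = #Q := by rw [card_map, card_attach]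
    rw [← hcard]
    apply SimpleGraph.IsClique.card_le_cliqueNum
    intro u hu v hv huv
    obtain ⟨x, hx, rfl⟩ := mem_map.1 (mem_coe.1 hu)
    obtain ⟨y, hy, rfl⟩ := mem_map.1 (mem_coe.1 hv)
    exact hQc x.2 y.2 (fun e => huv (by simp [e])))
  refine ⟨SimpleGraph.Coloring.mk (fun v => ⟨c v, hc v (by simp)⟩) fun {u v} huv e => ?_⟩
  exact hc' u (by simp) v (by simp) huv (by simpa using e)

/-- Deleting the vertex `i` from a cycle leaves a path whose ends are the neighbours of `i`. -/
lemma exists_pathGraph_embedding_cycleGraph {n : ℕ} (hn : 3 ≤ n) (i : Fin n) :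
    ∃ p : pathGraph (n - 1) ↪g cycleGraph n, ∀ j, p j ≠ i ∧
      ((cycleGraph n).Adj i (p j) ↔ j.val = 0 ∨ j.val = n - 2) := by
  have : NeZero n := ⟨by omega⟩
  let q : Fin (n - 1) → Fin n := fun j => i + ⟨j.val + 1, by omega⟩
  have hq : ∀ j k, q j - q k = (⟨j.val + 1, by omega⟩ : Fin n) - ⟨k.val + 1, by omega⟩ :=
    fun j k => add_sub_add_left_eq_sub _ _ _
  have hqi : ∀ j, q j - i = ⟨j.val + 1, by omega⟩ := fun j => add_sub_cancel_left _ _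
  have hiq : ∀ j, i - q j = 0 - ⟨j.val + 1, by omega⟩ := fun j => by simp [q]
  have hval : ∀ a b : Fin n, (a - b).val = if b.val ≤ a.val then a.val - b.val
      else n + a.val - b.val := by
    intro a b
    split_ifs with h
    · exact Fin.sub_val_of_le h
    · exact Fin.coe_sub_iff_lt.2 (not_le.1 h)
  refine ⟨⟨⟨q, fun j k h => ?_⟩, fun {j k} => ?_⟩, fun j => ⟨fun h => ?_, ?_⟩⟩
  · have := add_left_cancel h
    simp only [Fin.mk.injEq, Nat.add_right_cancel_iff] at this
    exact Fin.ext this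
  · change (cycleGraph n).Adj (q j) (q k) ↔ _
    rw [cycleGraph_adj', pathGraph_adj, hq, hq, hval, hval]
    have := j.isLt
    have := k.isLt
    dsimp only
    split_ifs <;> omega
  · have h1 := hqi j
    change q j = i at h
    rw [h, sub_self] at h1
    simpa using congrArg Fin.val h1
  · change (cycleGraph n).Adj i (q j) ↔ _
    rw [cycleGraph_adj', hiq, hqi, hval]
    have := j.isLt
    rw [if_neg (by simp)]
    simp only [Fin.coe_ofNat_eq_mod, Nat.zero_mod]
    omega

/-- The graph obtained from `G` by replacing the neighbourhood of `a` by `N`. -/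
def reattach (G : SimpleGraph V) (a : V) (N : Set V) : SimpleGraph V where
  Adj u v := (u ≠ a ∧ v ≠ a ∧ G.Adj u v) ∨ (u = a ∧ v ≠ a ∧ v ∈ N) ∨ (v = a ∧ u ≠ a ∧ u ∈ N)
  symm := ⟨fun u v h => by
    have := G.adj_comm u v
    tauto⟩
  loopless := ⟨fun v h => by
    have := G.irrefl (v := v)
    tauto⟩

lemma reattach_adj_of_ne {G : SimpleGraph V} {a : V} {N : Set V} {u v : V} (hu : u ≠ a)
    (hv : v ≠ a) : (reattach G a N).Adj u v ↔ G.Adj u v := by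
  simp [reattach, hu, hv]

lemma reattach_adj_left {G : SimpleGraph V} {a : V} {N : Set V} {v : V} (hv : v ≠ a) :
    (reattach G a N).Adj a v ↔ v ∈ N := by
  simp [reattach, hv]

/-- An embedding into `reattach G a N` that avoids `a` is an embedding into `G`. -/
lemma exists_embedding_of_avoids {α : Type} {X : SimpleGraph α} {G : SimpleGraph V} {a : V}
    {N : Set V} (F : X ↪g reattach G a N) (hF : ∀ x, F x ≠ a) :
    ∃ F' : X ↪g G, ∀ x, F' x = F x :=
  ⟨⟨F.toEmbedding, fun {x y} => by
    rw [← F.map_adj_iff, reattach_adj_of_ne (hF x) (hF y)]; rfl⟩, fun _ => rfl⟩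

lemma exists_embedding_compl_of_avoids {α : Type} {X : SimpleGraph α} {G : SimpleGraph V} {a : V}
    {N : Set V} (F : X ↪g (reattach G a N)ᶜ) (hF : ∀ x, F x ≠ a) :
    ∃ F' : X ↪g Gᶜ, ∀ x, F' x = F x :=
  ⟨⟨F.toEmbedding, fun {x y} => by
    rw [← F.map_adj_iff, compl_adj, compl_adj, reattach_adj_of_ne (hF x) (hF y)]; rfl⟩,
    fun _ => rfl⟩

/-- The inclusion of the complement of an induced subgraph. -/
lemma exists_embedding_induce_compl (G : SimpleGraph V) (s : Set V) :
    ∃ F : (G.induce s)ᶜ ↪g Gᶜ, ∀ x, F x = x :=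
  ⟨⟨Function.Embedding.subtype _, fun {x y} => by simp [compl_adj, Subtype.ext_iff]⟩, fun _ => rfl⟩

lemma isBerge_induce {G : SimpleGraph V} (hG : IsBerge G) (s : Set V) :
    IsBerge (G.induce s) := by
  intro n hn hodd
  obtain ⟨F, -⟩ := exists_embedding_induce_compl G s
  exact ⟨fun ⟨f⟩ => (hG n hn hodd).1 ⟨(SimpleGraph.Embedding.induce s).comp f⟩,
    fun ⟨f⟩ => (hG n hn hodd).2 ⟨F.comp f⟩⟩

lemma isBerge_compl {G : SimpleGraph V} (hG : IsBerge G) : IsBerge Gᶜ := by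
  intro n hn hodd
  rw [compl_compl]
  exact (hG n hn hodd).symm

/-- Balancedness guarantees that a new vertex attached to `B₁` keeps one side of the skew
partition Berge. -/
lemma isBerge_reattach {G : SimpleGraph V} (hG : IsBerge G) {A B B₁ B₂ s : Set V} {a : V}
    (hbal : IsBalancedPair G A B) (hB : B₁ ∪ B₂ = B)
    (hB₁₂ : ∀ x ∈ B₁, ∀ y ∈ B₂, G.Adj x y) (hs : s ⊆ A ∪ B) :
    IsBerge ((reattach G a B₁).induce s) := by
  have hsub₁ : ∀ v, v ∈ B₁ → v ∈ B := fun v h => hB ▸ Or.inl h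
  have hsplit : ∀ v, v ∈ B → v ∈ B₁ ∨ v ∈ B₂ := fun v h => by rwa [← hB] at h
  intro n hn hodd
  constructor
  · rintro ⟨f⟩
    let F : cycleGraph n ↪g reattach G a B₁ := (SimpleGraph.Embedding.induce s).comp f
    have hFs : ∀ i, F i ∈ s := fun i => (f i).2
    by_cases hav : ∀ i, F i ≠ a
    · obtain ⟨F', -⟩ := exists_embedding_of_avoids F hav
      exact (hG n hn hodd).1 ⟨F'⟩
    push Not at hav
    obtain ⟨i, hi⟩ := hav
    obtain ⟨p, hp⟩ := exists_pathGraph_embedding_cycleGraph (by omega) i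
    have hne : ∀ j, (F.comp p) j ≠ a := fun j h => (hp j).1 (F.injective (h.trans hi.symm))
    obtain ⟨g, hg⟩ := exists_embedding_of_avoids (F.comp p) hne
    have hN : ∀ j, g j ∈ B₁ ↔ j.val = 0 ∨ j.val = n - 2 := by
      intro j
      rw [← (hp j).2, ← F.map_adj_iff, hi, hg]
      exact (reattach_adj_left (hne j)).symm
    have hgs : ∀ j, g j ∈ A ∪ B := fun j => by rw [hg]; exact hs (hFs _)
    have h0 : g ⟨0, by omega⟩ ∈ B₁ := (hN _).2 (Or.inl rfl)
    have h1 : g ⟨n - 1 - 1, by omega⟩ ∈ B₁ := (hN _).2 (Or.inr rfl)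
    have := hbal.1 (n - 1) (by omega) g (hsub₁ _ h0) (hsub₁ _ h1) (by
      intro j hj0 hj1
      rcases hgs j with h | h
      · exact h
      rcases hsplit _ h with h | h
      · have := (hN j).1 h
        omega
      · have e0 := g.map_adj_iff.1 (hB₁₂ _ h0 _ h)
        have e1 := g.map_adj_iff.1 (hB₁₂ _ h1 _ h)
        rw [pathGraph_adj] at e0 e1
        simp only at e0 e1
        omega)
    grind
  · rintro ⟨f⟩
    obtain ⟨I, hI⟩ := exists_embedding_induce_compl (reattach G a B₁) s
    let F : cycleGraph n ↪g (reattach G a B₁)ᶜ := I.comp f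
    have hFs : ∀ i, F i ∈ s := fun i => by
      change I (f i) ∈ s
      rw [hI]
      exact (f i).2
    by_cases hav : ∀ i, F i ≠ a
    · obtain ⟨F', -⟩ := exists_embedding_compl_of_avoids F hav
      exact (hG n hn hodd).2 ⟨F'⟩
    push Not at hav
    obtain ⟨i, hi⟩ := hav
    obtain ⟨p, hp⟩ := exists_pathGraph_embedding_cycleGraph (by omega) i
    have hne : ∀ j, (F.comp p) j ≠ a := fun j h => (hp j).1 (F.injective (h.trans hi.symm))
    obtain ⟨g, hg⟩ := exists_embedding_compl_of_avoids (F.comp p) hne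
    have hN : ∀ j, g j ∉ B₁ ↔ j.val = 0 ∨ j.val = n - 2 := by
      intro j
      rw [← (hp j).2, ← F.map_adj_iff, hi, hg, compl_adj]
      have h := reattach_adj_left (G := G) (N := B₁) (hne j)
      change _ ↔ a ≠ (F.comp p) j ∧ ¬ (reattach G a B₁).Adj a ((F.comp p) j)
      rw [h]
      exact ⟨fun h => ⟨(hne j).symm, h⟩, fun h => h.2⟩
    have hgs : ∀ j, g j ∈ A ∪ B := fun j => by rw [hg]; exact hs (hFs _)
    have hint : ∀ j : Fin (n - 1), j.val ≠ 0 → j.val ≠ n - 1 - 1 → g j ∈ B₁ := by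
      intro j hj0 hj1
      by_contra h
      have := (hN j).1 h
      omega
    have hend : ∀ j k : Fin (n - 1), (j.val = 0 ∨ j.val = n - 2) → k.val ≠ 0 →
        k.val ≠ n - 1 - 1 → (pathGraph (n - 1)).Adj j k → g j ∈ A := by
      intro j k hj hk hk' hjk
      rcases hgs j with h | h
      · exact h
      rcases hsplit _ h with h | h
      · exact absurd h ((hN j).2 hj)
      · have := g.map_adj_iff.2 hjk
        rw [compl_adj] at this
        exact absurd (hB₁₂ _ (hint k hk hk') _ h).symm this.2
    have := hbal.2 (n - 1) (by omega) g
      (hend _ ⟨1, by omega⟩ (Or.inl rfl) (by simp) (by simp; omega) (by simp [pathGraph_adj]))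
      (hend _ ⟨n - 3, by omega⟩ (Or.inr rfl) (by simp; omega) (by simp; omega)
        (by rw [pathGraph_adj]; simp only; omega))
      (fun j h h' => hsub₁ _ (hint j h h'))
    grind

/-- If `a` is attached to `B₁` with weight `n - k`, an optimal cover separates `B₁` from `B₂`. -/
lemma exists_separating_subset [Fintype V] {G : SimpleGraph V} {U B₁ B₂ K : Finset V} {a : V}
    {n : ℕ} (haU : a ∉ U) (hB₁U : B₁ ⊆ U)
    (hperf : ∀ t ⊆ insert a U, OptimallyColorableOn (reattach G a B₁) t)
    (hB₁₂ : ∀ x ∈ B₁, ∀ y ∈ B₂, G.Adj x y) (hn : CliqueBound G univ n)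
    (hKB : K ⊆ B₁) (hK : G.IsClique (K : Set V)) (hKmax : CliqueBound G B₁ #K) :
    ∃ C ⊆ U, B₁ ⊆ C ∧ Disjoint C B₂ ∧ CliqueBound G C #K ∧ CliqueBound G (U \ C) (n - #K) := by
  set H := reattach G a B₁ with hH
  have hkn : #K ≤ n := hn K (subset_univ _) hK
  have hUne : ∀ v ∈ U, v ≠ a := fun v hv h => haU (h ▸ hv)
  have toH : ∀ Q ⊆ U, G.IsClique (Q : Set V) → H.IsClique (Q : Set V) := fun Q hQ hQc u hu v hv huv =>
    (reattach_adj_of_ne (hUne u (hQ hu)) (hUne v (hQ hv))).2 (hQc hu hv huv)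
  set w : V → ℕ := fun v => if v = a then n - #K else if v ∈ U then 1 else 0 with hw
  have hwU : ∀ v ∈ U, w v = 1 := fun v hv => by simp [hw, hUne v hv, hv]
  have hwne : ∀ v, v ≠ a → w v = if v ∈ U then 1 else 0 := fun v hv => by simp [hw, hv]
  obtain ⟨f, hf, hfw⟩ := exists_weighted_cover hperf _ w n le_rfl
    (by
      intro v hv
      by_contra hv'
      simp only [mem_insert, not_or] at hv'
      simp [hw, hv'.1, hv'.2] at hv)
    (by
      intro Q hQ
      by_cases haQ : a ∈ Q
      · rw [← add_sum_erase _ _ haQ]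
        have h1 : Q.erase a ⊆ B₁ := by
          intro v hv
          have hva := ne_of_mem_erase hv
          exact_mod_cast (reattach_adj_left hva).1 (hQ haQ (mem_of_mem_erase hv) hva.symm)
        have h2 : ∑ v ∈ Q.erase a, w v = #(Q.erase a) := by
          rw [card_eq_sum_ones]
          exact sum_congr rfl fun v hv => hwU v (hB₁U (h1 hv))
        have h3 := hKmax _ h1 (fun u hu v hv huv =>
          (reattach_adj_of_ne (ne_of_mem_erase hu) (ne_of_mem_erase hv)).1
            (hQ (mem_of_mem_erase hu) (mem_of_mem_erase hv) huv))
        have h4 : w a = n - #K := by simp [hw]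
        omega
      · have hne : ∀ v ∈ Q, v ≠ a := fun v hv h => haQ (h ▸ hv)
        rw [sum_congr rfl fun v hv => hwne v (hne v hv), ← card_filter]
        refine hn _ (subset_univ _) fun u hu v hv huv => ?_
        rw [mem_coe, mem_filter] at hu hv
        exact (reattach_adj_of_ne (hne u hu.1) (hne v hv.1)).1 (hQ hu.1 hv.1 huv))
  set J : Finset ℕ := (range n).filter (fun i => a ∉ f i) with hJ
  have hJle : #J ≤ #K := by
    have h1 := hfw a
    have h2 : w a = n - #K := by simp [hw]
    have h3 : #{i ∈ range n | a ∈ f i} + #J = #(range n) := by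
      convert card_filter_add_card_filter_not (s := range n) (fun i => a ∈ f i)
    rw [card_range] at h3
    omega
  have hB₁J : ∀ b ∈ B₁, 1 ≤ #{i ∈ J | b ∈ f i} := by
    intro b hb
    have h1 := hfw b
    rw [hwU b (hB₁U hb)] at h1
    refine h1.trans (card_le_card fun i hi => ?_)
    rw [mem_filter] at hi ⊢
    refine ⟨mem_filter.2 ⟨hi.1, fun hai => ?_⟩, hi.2⟩
    have hba := hUne b (hB₁U hb)
    exact hf i hai hi.2 hba.symm ((reattach_adj_left hba).2 hb)
  have hKJ : #K ≤ #{i ∈ J | (K ∩ f i).Nonempty} := by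
    rw [card_eq_sum_ones]
    exact (sum_le_sum fun v hv => hB₁J v (hKB hv)).trans
      (sum_card_cover_le (toH K (hKB.trans hB₁U) hK) hf J)
  have hJeq : J.filter (fun i => (K ∩ f i).Nonempty) = J :=
    eq_of_subset_of_card_le (filter_subset _ _) (hJle.trans hKJ)
  rw [hJeq] at hKJ
  refine ⟨U.filter (fun v => ∃ i ∈ J, v ∈ f i), filter_subset _ _, fun b hb => ?_, ?_, ?_, ?_⟩
  · obtain ⟨i, hi⟩ := card_pos.1 (hB₁J b hb)
    rw [mem_filter] at hi
    exact mem_filter.2 ⟨hB₁U hb, i, hi⟩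
  · rw [Finset.disjoint_left]
    intro v hv hvB
    rw [mem_filter] at hv
    obtain ⟨hvU, i, hi, hvi⟩ := hv
    rw [← hJeq, mem_filter] at hi
    obtain ⟨b, hb⟩ := hi.2
    rw [mem_inter] at hb
    have hadj := hB₁₂ b (hKB hb.1) v hvB
    exact hf i hb.2 hvi hadj.ne
      ((reattach_adj_of_ne (hUne b (hB₁U (hKB hb.1))) (hUne v hvU)).2 hadj)
  · intro Q hQ hQc
    refine le_trans ?_ ((sum_card_cover_le (toH Q (hQ.trans (filter_subset _ _)) hQc) hf J).trans
      ((card_filter_le _ _).trans hJle))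
    rw [card_eq_sum_ones]
    refine sum_le_sum fun v hv => card_pos.2 ?_
    obtain ⟨i, hi⟩ := (mem_filter.1 (hQ hv)).2
    exact ⟨i, mem_filter.2 hi⟩
  · intro Q hQ hQc
    have hQU := hQ.trans sdiff_subset
    have h1 : #(range n \ J) ≤ n - #K := by
      rw [card_sdiff_of_subset (show J ⊆ range n from filter_subset _ _), card_range]
      omega
    refine le_trans ?_ ((sum_card_cover_le (toH Q hQU hQc) hf (range n \ J)).trans
      ((card_filter_le _ _).trans h1))
    rw [card_eq_sum_ones]
    refine sum_le_sum fun v hv => card_pos.2 ?_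
    have h2 := hfw v
    rw [hwU v (hQU hv)] at h2
    obtain ⟨i, hi⟩ := card_pos.1 h2
    rw [mem_filter] at hi
    refine ⟨i, mem_filter.2 ⟨mem_sdiff.2 ⟨hi.1, fun hiJ => ?_⟩, hi.2⟩⟩
    exact (mem_sdiff.1 (hQ hv)).2 (mem_filter.2 ⟨hQU hv, i, hiJ, hi.2⟩)

/-- A Berge graph all of whose smaller Berge graphs are perfect is perfect as soon as it has a
balanced skew partition. -/
theorem isPerfect_of_isBalancedPair [Fintype V] {G : SimpleGraph V} (hberge : IsBerge G)
    (hmin : ∀ (W : Type) [Fintype W] (H : SimpleGraph W),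
        Fintype.card W < Fintype.card V → IsBerge H → IsPerfect H)
    {A B : Set V} (hskew : IsSkewPartition G A B) (hbal : IsBalancedPair G A B) :
    IsPerfect G := by
  obtain ⟨hAB, hcov, ⟨X₁, X₂, ⟨x₁, hx₁⟩, ⟨x₂, hx₂⟩, hdX, rfl, hX⟩,
    ⟨Y₁, Y₂, ⟨y₁, hy₁⟩, ⟨y₂, hy₂⟩, hdY, rfl, hY⟩⟩ := hskew
  have small : ∀ (H : SimpleGraph V) (s : Set V) (z : V), z ∉ s → IsBerge (H.induce s) →
      ∀ t : Finset V, (t : Set V) ⊆ s → OptimallyColorableOn H t := by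
    intro H s z hz hH t ht
    exact optimallyColorableOn_of_isPerfect_induce
      (hmin s _ (Fintype.card_subtype_lt hz) hH) ht
  have proper : ∀ H : SimpleGraph V, IsBerge H → ∀ t : Finset V, t ≠ univ →
      OptimallyColorableOn H t := by
    intro H hH t ht
    obtain ⟨z, hz⟩ : ∃ z, z ∉ t := by
      by_contra! h
      exact ht (eq_univ_iff_forall.2 h)
    exact small H t z (by simpa using hz) (isBerge_induce hH _) t subset_rfl
  by_contra himp
  have hcov' : ∀ v, (v ∈ X₁ ∨ v ∈ X₂) ∨ (v ∈ Y₁ ∨ v ∈ Y₂) := fun v => by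
    have : v ∈ (X₁ ∪ X₂) ∪ (Y₁ ∪ Y₂) := hcov ▸ Set.mem_univ v
    simpa using this
  have hYadj : ∀ x ∈ Y₁, ∀ y ∈ Y₂, G.Adj x y := by
    intro x hx y hy
    have h := hY x hx y hy
    rw [compl_adj] at h
    by_contra h'
    exact h ⟨fun e => Set.disjoint_left.1 hdY hx (e ▸ hy), h'⟩
  have hdAB : ∀ v, (v ∈ X₁ ∨ v ∈ X₂) → ¬ (v ∈ Y₁ ∨ v ∈ Y₂) := fun v h h' =>
    Set.disjoint_left.1 hAB h h'
  have hdX' : ∀ v, v ∈ X₁ → v ∉ X₂ := fun v h h' => Set.disjoint_left.1 hdX h h'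
  have hdY' : ∀ v, v ∈ Y₁ → v ∉ Y₂ := fun v h h' => Set.disjoint_left.1 hdY h h'
  have single : ∀ a ∈ X₁ ∪ X₂, ∃ v ∈ X₁ ∪ X₂, v ≠ a ∧ G.Adj a v := by
    intro a ha
    by_contra! hcon
    have hstar := optimallyColorableOn_univ_of_starCutset (H := Gᶜ)
      (proper _ (isBerge_compl hberge)) (A := (X₁ ∪ X₂).toFinset) (X := Y₁.toFinset)
      (Y := Y₂.toFinset) (a := a) (fun v => by have := hcov' v; simpa using this)
      ⟨y₁, by simpa using hy₁⟩ ⟨y₂, by simpa using hy₂⟩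
      (by rw [Finset.disjoint_left]; intro v; have := hdAB v; simp; tauto)
      (by rw [Finset.disjoint_left]; intro v; have := hdAB v; simp; tauto)
      (by rw [Finset.disjoint_left]; intro v; have := hdY' v; simpa using this)
      (fun x hx y hy => hY x (by simpa using hx) y (by simpa using hy)) (by simpa using ha)
      (fun v hv hva => by
        rw [compl_adj]
        exact ⟨hva.symm, hcon v (by simpa using hv) hva⟩)
    refine himp (isPerfect_of_optimallyColorableOn fun t => ?_)
    have := optimallyColorableOn_compl (G := Gᶜ) (fun t => by
      by_cases ht : t = univ
      · exact ht ▸ hstar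
      · exact proper _ (isBerge_compl hberge) t ht) _ t le_rfl
    rwa [compl_compl] at this
  have notOpt : ¬ OptimallyColorableOn G univ := fun h =>
    himp (isPerfect_of_optimallyColorableOn fun t => by
      by_cases ht : t = univ
      · exact ht ▸ h
      · exact proper _ hberge t ht)
  refine notOpt fun n hn => ?_
  obtain ⟨K, hK, hKmax⟩ := exists_max_image
    (Y₁.toFinset.powerset.filter fun Q : Finset V => G.IsClique (Q : Set V)) card ⟨∅, by simp⟩
  rw [mem_filter, mem_powerset] at hK
  have hKmax' : CliqueBound G Y₁.toFinset #K := fun Q hQ hQc =>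
    hKmax Q (mem_filter.2 ⟨mem_powerset.2 hQ, hQc⟩)
  have split : ∀ (P : Set V) (a z : V), P ⊆ X₁ ∪ X₂ → a ∈ X₁ ∪ X₂ → z ∈ X₁ ∪ X₂ → a ≠ z →
      a ∉ P → z ∉ P → ∃ C ⊆ (P ∪ (Y₁ ∪ Y₂)).toFinset, Y₁.toFinset ⊆ C ∧ Disjoint C Y₂.toFinset ∧
        CliqueBound G C #K ∧ CliqueBound G ((P ∪ (Y₁ ∪ Y₂)).toFinset \ C) (n - #K) := by
    intro P a z hP ha hz haz haP hzP
    have haY := hdAB a ha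
    have hzY := hdAB z hz
    refine exists_separating_subset (a := a) (by simp [haP]; simpa using haY)
      (fun v hv => by simp at hv ⊢; tauto) ?_ (by simpa using hYadj) hn hK.1 hK.2 hKmax'
    intro t ht
    rw [Set.coe_toFinset]
    refine small _ (insert a (P ∪ (Y₁ ∪ Y₂))) z (by simp [haz.symm, hzP]; simpa using hzY)
      (isBerge_reattach hberge hbal rfl hYadj ?_) t ?_
    · rintro v (rfl | hv | hv)
      · exact Or.inl ha
      · exact Or.inl (hP hv)
      · exact Or.inr hv
    · intro v hv
      simpa using ht hv
  have two : ∀ P Q : Set V, P ∪ Q = X₁ ∪ X₂ → (∀ u ∈ P, ∀ v ∈ Q, ¬ G.Adj u v) → ∀ a ∈ Q,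
      ∃ z ∈ Q, a ≠ z := by
    intro P Q hPQ hno a ha
    obtain ⟨v, hv, hva, hadj⟩ := single a (hPQ ▸ Or.inr ha)
    rw [← hPQ] at hv
    rcases hv with hv | hv
    · exact absurd hadj.symm (hno v hv a ha)
    · exact ⟨v, hv, hva.symm⟩
  obtain ⟨z₂, hz₂, hne₂⟩ := two X₁ X₂ rfl hX x₂ hx₂
  obtain ⟨z₁, hz₁, hne₁⟩ := two X₂ X₁ (Set.union_comm _ _)
    (fun u hu v hv h => hX v hv u hu h.symm) x₁ hx₁
  obtain ⟨C₁, hC₁, hYC₁, hdC₁, hb₁, hr₁⟩ := split X₁ x₂ z₂ (fun _ => Or.inl) (Or.inr hx₂)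
    (Or.inr hz₂) hne₂ (fun h => hdX' _ h hx₂) (fun h => hdX' _ h hz₂)
  obtain ⟨C₂, hC₂, hYC₂, hdC₂, hb₂, hr₂⟩ := split X₂ x₁ z₁ (fun _ => Or.inr) (Or.inl hx₁)
    (Or.inl hz₁) hne₁ (hdX' _ hx₁) (hdX' _ hz₁)
  rw [Finset.disjoint_left] at hdC₁ hdC₂
  have mC₁ : ∀ v ∈ C₁, v ∈ X₁ ∨ v ∈ Y₁ ∨ v ∈ Y₂ := fun v hv => by simpa using hC₁ hv
  have mC₂ : ∀ v ∈ C₂, v ∈ X₂ ∨ v ∈ Y₁ ∨ v ∈ Y₂ := fun v hv => by simpa using hC₂ hv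
  simp only [Set.mem_toFinset] at hdC₁ hdC₂
  have iC₁ : ∀ v ∈ Y₁, v ∈ C₁ := fun v hv => hYC₁ (by simpa using hv)
  have iC₂ : ∀ v ∈ Y₁, v ∈ C₂ := fun v hv => hYC₂ (by simpa using hv)
  have side : ∀ Q : Finset V, G.IsClique (Q : Set V) → (∀ v ∈ Q, v ∉ X₂) ∨ ∀ v ∈ Q, v ∉ X₁ := by
    intro Q hQ
    by_contra! h
    obtain ⟨⟨u, huQ, hu⟩, v, hvQ, hv⟩ := h
    exact hX v hv u hu (hQ hvQ huQ fun e => hdX' v hv (e ▸ hu))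
  have col₁ : ColorableOn G (C₁ ∪ C₂) #K := by
    refine proper G hberge _ (fun h => ?_) _ fun Q hQ hQc => ?_
    · have := mem_univ y₂
      rw [← h, mem_union] at this
      exact this.elim (fun h => hdC₁ h hy₂) (fun h => hdC₂ h hy₂)
    · have mQ : ∀ v ∈ Q, v ∈ C₁ ∨ v ∈ C₂ := fun v hv => mem_union.1 (hQ hv)
      rcases side Q hQc with h | h
      · refine hb₁ Q (fun v hv => ?_) hQc
        have := mQ v hv; have := h v hv; have := mC₂ v; have := iC₁ v; have := @hdC₂ v
        tauto
      · refine hb₂ Q (fun v hv => ?_) hQc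
        have := mQ v hv; have := h v hv; have := mC₁ v; have := iC₂ v; have := @hdC₁ v
        tauto
  have col₂ : ColorableOn G (univ \ (C₁ ∪ C₂)) (n - #K) := by
    refine proper G hberge _ (fun h => ?_) _ fun Q hQ hQc => ?_
    · have := mem_univ y₁
      rw [← h, mem_sdiff, mem_union] at this
      exact this.2 (Or.inl (iC₁ y₁ hy₁))
    · have mQ : ∀ v ∈ Q, ¬ (v ∈ C₁ ∨ v ∈ C₂) := fun v hv => by
        have := hQ hv
        rwa [mem_sdiff, mem_union, and_iff_right (mem_univ v)] at this
      rcases side Q hQc with h | h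
      · refine hr₁ Q (fun v hv => ?_) hQc
        rw [mem_sdiff, Set.mem_toFinset, Set.mem_union, Set.mem_union]
        have := mQ v hv; have := h v hv; have := hcov' v
        tauto
      · refine hr₂ Q (fun v hv => ?_) hQc
        rw [mem_sdiff, Set.mem_toFinset, Set.mem_union, Set.mem_union]
        have := mQ v hv; have := h v hv; have := hcov' v
        tauto
  have hKn : #K ≤ n := hn K (subset_univ _) hK.2
  exact (col₁.union col₂).mono (union_sdiff_of_subset (subset_univ _)).ge (by omega)

end

end BergeSkew

/-- A minimum imperfect Berge graph admits no balanced skew partition. -/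
theorem min_imperfect_berge_no_balanced_skew_partition {V : Type} [Fintype V]
    (G : SimpleGraph V) (hberge : IsBerge G) (himp : ¬ IsPerfect G)
    (hmin : ∀ (W : Type) [Fintype W] (H : SimpleGraph W),
        Fintype.card W < Fintype.card V → IsBerge H → IsPerfect H) :
    ¬ ∃ A B : Set V, IsSkewPartition G A B ∧ IsBalancedPair G A B := by
  rintro ⟨A, B, hskew, hbal⟩
  exact himp (BergeSkew.isPerfect_of_isBalancedPair hberge hmin hskew hbal)
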